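/- Suppose 0 < β ≤ 1/2, and suppose that for every m ∈ ℝ, V_m is a bounded function on Δ satisfying the Bellman equation for subsidy m. Then the single-armed bandit is indexable: for all ω ∈ Δ and all m ≤ m', if m + β V_m(ωP) ≥ ω·B + β Σ_{k<K} ω_k V_m(p_k), then m' + β V_{m'}(ωP) ≥ ω·B + β Σ_{k<K} ω_k V_{m'}(p_k). -/

import Mathlib

open Matrix

lemma row_mem_stdSimplex {K : ℕ} {P : Matrix (Fin K) (Fin K) ℝ}
    (hPnn : ∀ i j, 0 ≤ P i j) (hProw : ∀ i, ∑ j, P i j = 1) (k : Fin K) :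
    P k ∈ stdSimplex ℝ (Fin K) :=
  ⟨hPnn k, hProw k⟩

lemma vecMul_mem_stdSimplex {K : ℕ} {P : Matrix (Fin K) (Fin K) ℝ}
    (hPnn : ∀ i j, 0 ≤ P i j) (hProw : ∀ i, ∑ j, P i j = 1) {ω : Fin K → ℝ}
    (hω : ω ∈ stdSimplex ℝ (Fin K)) : ω ᵥ* P ∈ stdSimplex ℝ (Fin K) := by
  refine ⟨fun j => dotProduct_nonneg_of_nonneg hω.1 fun i => hPnn i j, ?_⟩
  simp only [vecMul, dotProduct]
  rw [Finset.sum_comm]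
  simp [← Finset.mul_sum, hProw, hω.2]

/-- A function bounded above on `s` whose upper bounds are improved by `M ↦ e + β * M` is at most
the fixed point of this map. -/
lemma le_div_one_sub_of_bound_step {α : Type*} {s : Set α} {f : α → ℝ} {e β : ℝ} (hβ : β < 1)
    (hbdd : BddAbove (f '' s))
    (hstep : ∀ M, (∀ x ∈ s, f x ≤ M) → ∀ x ∈ s, f x ≤ e + β * M) {x : α} (hx : x ∈ s) :
    f x ≤ e / (1 - β) := by
  have hle : ∀ y ∈ s, f y ≤ sSup (f '' s) := fun y hy => le_csSup hbdd ⟨y, hy, rfl⟩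
  have hsup : sSup (f '' s) ≤ e + β * sSup (f '' s) := by
    refine csSup_le ⟨f x, x, hx, rfl⟩ ?_
    rintro _ ⟨y, hy, rfl⟩
    exact hstep _ hle y hy
  refine (hle x hx).trans ?_
  rw [le_div_iff₀ (by linarith)]
  linarith

lemma sum_mul_le_sum_mul_add {K : ℕ} {ω f g : Fin K → ℝ} {M : ℝ}
    (hω : ω ∈ stdSimplex ℝ (Fin K)) (h : ∀ k, f k - g k ≤ M) :
    ∑ k, ω k * f k ≤ ∑ k, ω k * g k + M := by
  calc ∑ k, ω k * f k ≤ ∑ k, (ω k * g k + ω k * M) :=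
        Finset.sum_le_sum fun k _ => by nlinarith [h k, hω.1 k]
    _ = ∑ k, ω k * g k + M := by
        rw [Finset.sum_add_distrib, ← Finset.sum_mul, hω.2, one_mul]

/-- Comparison of bounded solutions of the Bellman equation for two subsidies. -/
lemma bellman_sub_le {K : ℕ} {P : Matrix (Fin K) (Fin K) ℝ}
    (hPnn : ∀ i j, 0 ≤ P i j) (hProw : ∀ i, ∑ j, P i j = 1)
    {B : Fin K → ℝ} {β : ℝ} (hβ₀ : 0 < β) (hβ₁ : β < 1) {U W : (Fin K → ℝ) → ℝ} {m n e : ℝ}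
    (hU : ∃ C, ∀ ω ∈ stdSimplex ℝ (Fin K), |U ω| ≤ C)
    (hW : ∃ C, ∀ ω ∈ stdSimplex ℝ (Fin K), |W ω| ≤ C)
    (hUBell : ∀ ω ∈ stdSimplex ℝ (Fin K),
      U ω = max (ω ⬝ᵥ B + β * ∑ k, ω k * U (P k)) (m + β * U (ω ᵥ* P)))
    (hWBell : ∀ ω ∈ stdSimplex ℝ (Fin K),
      W ω = max (ω ⬝ᵥ B + β * ∑ k, ω k * W (P k)) (n + β * W (ω ᵥ* P)))
    (he : 0 ≤ e) (hmn : m - n ≤ e) {ω : Fin K → ℝ} (hω : ω ∈ stdSimplex ℝ (Fin K)) :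
    U ω - W ω ≤ e / (1 - β) := by
  obtain ⟨C, hC⟩ := hU
  obtain ⟨D, hD⟩ := hW
  refine le_div_one_sub_of_bound_step (f := fun ω => U ω - W ω) hβ₁ ⟨C + D, ?_⟩ ?_ hω
  · rintro _ ⟨x, hx, rfl⟩
    linarith [(abs_le.mp (hC x hx)).2, (abs_le.mp (hD x hx)).1]
  · intro M hM x hx
    have hactive := (le_max_left _ _).trans_eq (hWBell x hx).symm
    have hpassive := (le_max_right _ _).trans_eq (hWBell x hx).symm
    have hsum := mul_le_mul_of_nonneg_left (sum_mul_le_sum_mul_add hx fun k =>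
      hM (P k) (row_mem_stdSimplex hPnn hProw k)) hβ₀.le
    have hnext := mul_le_mul_of_nonneg_left
      (hM (x ᵥ* P) (vecMul_mem_stdSimplex hPnn hProw hx)) hβ₀.le
    have hUx : U x ≤ W x + (e + β * M) := by
      rw [hUBell x hx]
      apply max_le <;> linarith
    linarith

/-- The restless bandit is indexable whenever `β ≤ 1/2`: once the passive action is
(weakly) optimal at `ω` for subsidy `m`, it remains so for every larger subsidy `m'`. -/
theorem indexable_of_beta_le_half (K : ℕ) (hK : 1 ≤ K)
    (P : Matrix (Fin K) (Fin K) ℝ)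
    (hPnn : ∀ i j, 0 ≤ P i j) (hProw : ∀ i, ∑ j, P i j = 1)
    (B : Fin K → ℝ) (hB : ∀ i, 0 ≤ B i)
    (β : ℝ) (hβ₀ : 0 < β) (hβ₁ : β < 1) (hβhalf : β ≤ 1 / 2)
    (V : ℝ → (Fin K → ℝ) → ℝ)
    (hbd : ∀ m : ℝ, ∃ C, ∀ ω ∈ stdSimplex ℝ (Fin K), |V m ω| ≤ C)
    (hBell : ∀ m : ℝ, ∀ ω ∈ stdSimplex ℝ (Fin K),
      V m ω = max (ω ⬝ᵥ B + β * ∑ k, ω k * V m (P k)) (m + β * V m (ω ᵥ* P))) :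
    ∀ ω ∈ stdSimplex ℝ (Fin K), ∀ m m' : ℝ, m ≤ m' →
      ω ⬝ᵥ B + β * ∑ k, ω k * V m (P k) ≤ m + β * V m (ω ᵥ* P) →
      ω ⬝ᵥ B + β * ∑ k, ω k * V m' (P k) ≤ m' + β * V m' (ω ᵥ* P) := by
  intro ω hω m m' hm hpassive
  have hrow : ∀ k, V m' (P k) - V m (P k) ≤ (m' - m) / (1 - β) := fun k =>
    bellman_sub_le hPnn hProw hβ₀ hβ₁ (hbd m') (hbd m) (hBell m') (hBell m)
      (by linarith) le_rfl (row_mem_stdSimplex hPnn hProw k)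
  have hmono : V m (ω ᵥ* P) - V m' (ω ᵥ* P) ≤ 0 / (1 - β) :=
    bellman_sub_le hPnn hProw hβ₀ hβ₁ (hbd m) (hbd m') (hBell m) (hBell m')
      le_rfl (by linarith) (vecMul_mem_stdSimplex hPnn hProw hω)
  rw [zero_div] at hmono
  have hsum := mul_le_mul_of_nonneg_left (sum_mul_le_sum_mul_add hω hrow) hβ₀.le
  have hnext := mul_le_mul_of_nonneg_left hmono hβ₀.le
  have hgap : β * ((m' - m) / (1 - β)) ≤ m' - m := by
    rw [← mul_div_assoc, div_le_iff₀ (by linarith)]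
    nlinarith
  linarith
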